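/- arXiv:2309.01044 — 2 statements merged into one kernel-verified Lean document; each statement's English description precedes it below -/
import Mathlib

section
/- Let A be an abelian category and X a subcategory of A. The following are equivalent: (i) X is an IKE-closed subcategory of A; (ii) X is a Serre subcategory of the torsion-free closure F(X); (iii) there exists a torsion-free class F of A such that X is a Serre subcategory of F. -/
/-!
Statement 3: For a subcategory `X` of an abelian category `A`, TFAE:
(i) `X` is an IKE-closed subcategory of `A`;
(ii) `X` is a Serre subcategory of its torsion-free closure `F(X)`;
(iii) there is a torsion-free class `F` of `A` such that `X` is a Serre
subcategory of `F`.
-/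

open CategoryTheory CategoryTheory.Limits

universe v u

variable {A : Type u} [Category.{v} A] [Abelian A]

/-- An additive subcategory: contains the zero objects and is closed under
isomorphisms and finite direct sums. -/
def IsAdditiveSubcat (P : A → Prop) : Prop :=
  (∀ Z : A, IsZero Z → P Z) ∧
  (∀ X Y : A, (X ≅ Y) → P X → P Y) ∧
  (∀ X Y : A, P X → P Y → P (X ⊞ Y))

/-- `P` is closed under extensions. -/
def ClosedUnderExtensions (P : A → Prop) : Prop :=
  ∀ S : CategoryTheory.ShortComplex A, S.ShortExact → P S.X₁ → P S.X₃ → P S.X₂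

/-- `P` is closed under subobjects. -/
def ClosedUnderSubobjects (P : A → Prop) : Prop :=
  ∀ (X Y : A) (f : X ⟶ Y), Mono f → P Y → P X

/-- `P` is closed under kernels of morphisms between its objects. -/
def ClosedUnderKernels (P : A → Prop) : Prop :=
  ∀ (X Y : A) (f : X ⟶ Y), P X → P Y → P (kernel f)

/-- `P` is closed under images of morphisms between its objects. -/
def ClosedUnderImages (P : A → Prop) : Prop :=
  ∀ (X Y : A) (f : X ⟶ Y), P X → P Y → P (image f)

/-- A torsion-free class of `A`. -/
def IsTorsionFreeClass (P : A → Prop) : Prop :=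
  IsAdditiveSubcat P ∧ ClosedUnderSubobjects P ∧ ClosedUnderExtensions P

/-- An IKE-closed subcategory of `A`: an additive subcategory closed under
images, kernels and extensions. -/
def IsIKEClosed (P : A → Prop) : Prop :=
  IsAdditiveSubcat P ∧ ClosedUnderImages P ∧ ClosedUnderKernels P ∧
    ClosedUnderExtensions P

/-- `S` is a Serre subcategory of the extension-closed subcategory `C`
(in the sense of exact categories): `S ⊆ C`, `S` is an additive subcategory,
and for any conflation `0 → X₁ → X₂ → X₃ → 0` of `C`, `S` is closed under
the conflation and under admissible subobjects and admissible quotients. -/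
def IsSerreSubcatOf (C S : A → Prop) : Prop :=
  (∀ X, S X → C X) ∧ IsAdditiveSubcat S ∧
  (∀ T : CategoryTheory.ShortComplex A, T.ShortExact → C T.X₁ → C T.X₂ → C T.X₃ →
    (S T.X₁ → S T.X₃ → S T.X₂)) ∧
  (∀ T : CategoryTheory.ShortComplex A, T.ShortExact → C T.X₁ → C T.X₂ → C T.X₃ →
    (S T.X₂ → S T.X₁ ∧ S T.X₃))

/-- The torsion-free closure `F(X)`. -/
def torsionFreeClosure (P : A → Prop) : A → Prop :=
  fun M => ∀ F : A → Prop, IsTorsionFreeClass F → (∀ N, P N → F N) → F M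

lemma shortExact_kernel_of_epi {M N : A} (p : M ⟶ N) [Epi p] :
    (ShortComplex.mk (kernel.ι p) p (kernel.condition p)).ShortExact where
  exact := ShortComplex.exact_of_f_is_kernel _ (kernelIsKernel p)

/-- The kernel of `e ≫ p` is the pullback of the kernel of `p` along `e`. -/
noncomputable def kernelCompIsoPullback {M N L : A} (e : M ⟶ N) (p : N ⟶ L) :
    kernel (e ≫ p) ≅ pullback e (kernel.ι p) where
  hom := pullback.lift (kernel.ι _) (kernel.lift p (kernel.ι (e ≫ p) ≫ e) (by simp))
    (kernel.lift_ι _ _ _).symm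
  inv := kernel.lift _ (pullback.fst _ _) (by simp [pullback.condition_assoc])
  hom_inv_id := by
    rw [← cancel_mono (kernel.ι (e ≫ p)), Category.assoc, kernel.lift_ι (e ≫ p),
      pullback.lift_fst, Category.id_comp]
  inv_hom_id := by
    apply pullback.hom_ext
    · rw [Category.assoc, pullback.lift_fst, kernel.lift_ι, Category.id_comp]
    · rw [Category.assoc, pullback.lift_snd, ← cancel_mono (kernel.ι p), Category.assoc,
        kernel.lift_ι, kernel.lift_ι_assoc, pullback.condition, Category.id_comp]

/-- The objects `W` such that every quotient of an object of `P` that embeds into `W` lies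
in `P`. -/
def HasImagesIn (P : A → Prop) (W : A) : Prop :=
  ∀ (M I : A) (e : M ⟶ I) (m : I ⟶ W), Epi e → Mono m → P M → P I

lemma hasImagesIn_of_closedUnderImages {P : A → Prop} (hP : IsAdditiveSubcat P)
    (hI : ClosedUnderImages P) {W : A} (hW : P W) : HasImagesIn P W := by
  intro M I e m _ _ hM
  have := strongEpi_of_epi e
  exact hP.2.1 _ _ (image.isoStrongEpiMono e m rfl).symm (hI M W (e ≫ m) hM hW)

lemma hasImagesIn_closedUnderSubobjects (P : A → Prop) :
    ClosedUnderSubobjects (HasImagesIn P) :=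
  fun _ _ f _ hY M I e m he _ hM => hY M I e (m ≫ f) he (mono_comp m f) hM

lemma IsIKEClosed.hasImagesIn_closedUnderExtensions {P : A → Prop} (hP : IsIKEClosed P) :
    ClosedUnderExtensions (HasImagesIn P) := by
  obtain ⟨⟨-, hiso, -⟩, -, hker, hext⟩ := hP
  intro S hS h₁ h₃ M I e m _ _ hM
  have := hS.mono_f
  let p := factorThruImage (m ≫ S.g)
  have hJ : P (image (m ≫ S.g)) :=
    h₃ M _ (e ≫ p) (image.ι _) (epi_comp e p) inferInstance hM
  have hpull : P (pullback e (kernel.ι p)) :=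
    hiso _ _ (kernelCompIsoPullback e p) (hker _ _ _ hM hJ)
  have hw : (kernel.ι p ≫ m) ≫ S.g = 0 := calc
    _ = kernel.ι p ≫ p ≫ image.ι (m ≫ S.g) := by rw [Category.assoc, image.fac]
    _ = 0 := by rw [kernel.condition_assoc, zero_comp]
  let l := hS.exact.lift (kernel.ι p ≫ m) hw
  have hl : l ≫ S.f = kernel.ι p ≫ m := hS.exact.lift_f _ hw
  have : Mono (l ≫ S.f) := hl ▸ mono_comp _ _
  have hK : P (kernel p) :=
    h₁ _ _ (pullback.snd e (kernel.ι p)) l inferInstance (mono_of_mono l S.f) hpull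
  exact hext _ (shortExact_kernel_of_epi p) hK hJ

lemma ClosedUnderExtensions.biprod {P : A → Prop} (hP : ClosedUnderExtensions P) {M N : A}
    (hM : P M) (hN : P N) : P (M ⊞ N) :=
  hP _ (ShortComplex.Splitting.ofHasBinaryBiproduct M N).shortExact hM hN

lemma IsIKEClosed.isTorsionFreeClass_hasImagesIn {P : A → Prop} (hP : IsIKEClosed P) :
    IsTorsionFreeClass (HasImagesIn P) := by
  refine ⟨⟨?_, ?_, ?_⟩, hasImagesIn_closedUnderSubobjects P,
    hP.hasImagesIn_closedUnderExtensions⟩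
  · intro Z hZ M I e m _ _ _
    exact hP.1.1 _ (IsZero.of_mono m hZ)
  · intro W W' i hW
    exact hasImagesIn_closedUnderSubobjects P _ _ i.inv inferInstance hW
  · intro W W' hW hW'
    exact hP.hasImagesIn_closedUnderExtensions.biprod hW hW'

lemma isTorsionFreeClass_torsionFreeClosure (P : A → Prop) :
    IsTorsionFreeClass (torsionFreeClosure P) := by
  refine ⟨⟨?_, ?_, ?_⟩, ?_, ?_⟩
  · exact fun Z hZ F hF _ => hF.1.1 Z hZ
  · exact fun M N i hM F hF hPF => hF.1.2.1 M N i (hM F hF hPF)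
  · exact fun M N hM hN F hF hPF => hF.1.2.2 M N (hM F hF hPF) (hN F hF hPF)
  · exact fun M N f hf hN F hF hPF => hF.2.1 M N f hf (hN F hF hPF)
  · exact fun S hS h₁ h₃ F hF hPF => hF.2.2 S hS (h₁ F hF hPF) (h₃ F hF hPF)

lemma IsIKEClosed.isSerreSubcatOf_torsionFreeClosure {P : A → Prop} (hP : IsIKEClosed P) :
    IsSerreSubcatOf (torsionFreeClosure P) P := by
  refine ⟨fun M hM F _ hPF => hPF M hM, hP.1, fun T hT _ _ _ => hP.2.2.2 T hT, ?_⟩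
  intro T hT _ _ hT₃ h₂
  have := hT.epi_g
  have h₃ : P T.X₃ :=
    hT₃ _ hP.isTorsionFreeClass_hasImagesIn
      (fun _ hN => hasImagesIn_of_closedUnderImages hP.1 hP.2.1 hN)
      _ _ T.g (𝟙 _) inferInstance inferInstance h₂
  exact ⟨hP.1.2.1 _ _ ((kernelIsKernel T.g).conePointUniqueUpToIso hT.fIsKernel)
    (hP.2.2.1 _ _ T.g h₂ h₃), h₃⟩

lemma IsSerreSubcatOf.isIKEClosed {F P : A → Prop} (hP : IsSerreSubcatOf F P)
    (hF : IsTorsionFreeClass F) : IsIKEClosed P := by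
  obtain ⟨hPF, hadd, hext, hserre⟩ := hP
  obtain ⟨-, hsub, hFext⟩ := hF
  have key : ∀ (M N : A) (f : M ⟶ N), P M → P N →
      P (kernel (factorThruImage f)) ∧ P (image f) := fun M N f hM hN =>
    hserre _ (shortExact_kernel_of_epi (factorThruImage f))
      (hsub _ _ (kernel.ι _) inferInstance (hPF _ hM)) (hPF _ hM)
      (hsub _ _ (image.ι f) inferInstance (hPF _ hN)) hM
  refine ⟨hadd, fun M N f hM hN => (key M N f hM hN).2, fun M N f hM hN => ?_, ?_⟩
  · exact hadd.2.1 _ _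
      ((kernelCompMono (factorThruImage f) (image.ι f)).symm ≪≫ kernelIsoOfEq (image.fac f))
      (key M N f hM hN).1
  · exact fun S hS h₁ h₃ =>
      hext S hS (hPF _ h₁) (hFext S hS (hPF _ h₁) (hPF _ h₃)) (hPF _ h₃) h₁ h₃

theorem IKE_closed_tfae (X : A → Prop) :
    List.TFAE
      [ IsIKEClosed X,
        IsSerreSubcatOf (torsionFreeClosure X) X,
        ∃ F : A → Prop, IsTorsionFreeClass F ∧ IsSerreSubcatOf F X ] := by
  tfae_have 1 → 2 := IsIKEClosed.isSerreSubcatOf_torsionFreeClosure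
  tfae_have 2 → 3 := fun h => ⟨_, isTorsionFreeClass_torsionFreeClosure X, h⟩
  tfae_have 3 → 1 := fun ⟨_, hF, h⟩ => h.isIKEClosed hF
  tfae_finish
end

section
/- Let R be a commutative noetherian ring, X a KE-closed subcategory of mod R, and Φ a subset of Ass X. Then X ∩ mod^ass_Φ R is a KE-closed subcategory of mod R satisfying Ass(X ∩ mod^ass_Φ R) = Φ. -/
/-! Statement 13: Let `R` be a commutative noetherian ring, `X` a KE-closed
subcategory of `mod R`, and `Φ ⊆ Ass X`. Then `X ∩ mod^ass_Φ R` is a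
KE-closed subcategory of `mod R` with `Ass (X ∩ mod^ass_Φ R) = Φ`. -/

open CategoryTheory

universe u

section Defs

variable (R : Type u) [CommRing R]

/-- `P` is a class of finitely generated `R`-modules (a subcategory of
`mod R`). -/
def IsSubcatOfFGMod (P : ModuleCat.{u} R → Prop) : Prop :=
  ∀ M : ModuleCat.{u} R, P M → Module.Finite R M

/-- `P` is an additive subcategory: it contains the zero modules and is
closed under isomorphisms and finite direct sums. -/
def MIsAdditive (P : ModuleCat.{u} R → Prop) : Prop :=
  (∀ M : ModuleCat.{u} R, Subsingleton M → P M) ∧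
  (∀ M N : ModuleCat.{u} R, (M ≃ₗ[R] N) → P M → P N) ∧
  (∀ M N : ModuleCat.{u} R, P M → P N → P (ModuleCat.of R (M × N)))

/-- `P` is closed under submodules. -/
def MClosedUnderSubmodules (P : ModuleCat.{u} R → Prop) : Prop :=
  ∀ (M : ModuleCat.{u} R) (N : Submodule R M), P M → P (ModuleCat.of R N)

/-- `P` is closed under kernels of `R`-linear maps between its members. -/
def MClosedUnderKernels (P : ModuleCat.{u} R → Prop) : Prop :=
  ∀ (M N : ModuleCat.{u} R) (f : M →ₗ[R] N), P M → P N →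
    P (ModuleCat.of R (LinearMap.ker f))

/-- `P` is closed under extensions: for every short exact sequence
`0 → N → M → M/N → 0`, if the two outer terms lie in `P` then so does `M`.
(Together with closure under isomorphisms this is equivalent to the usual
formulation with arbitrary short exact sequences.) -/
def MClosedUnderExtensions (P : ModuleCat.{u} R → Prop) : Prop :=
  ∀ (M : ModuleCat.{u} R) (N : Submodule R M),
    P (ModuleCat.of R N) → P (ModuleCat.of R (M ⧸ N)) → P M

/-- `P` is a torsion-free class of `mod R`: an additive subcategory of
finitely generated modules closed under submodules and extensions. -/
def MIsTorsionFreeClass (P : ModuleCat.{u} R → Prop) : Prop :=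
  IsSubcatOfFGMod R P ∧ MIsAdditive R P ∧ MClosedUnderSubmodules R P ∧
    MClosedUnderExtensions R P

/-- `P` is a KE-closed subcategory of `mod R`: an additive subcategory of
finitely generated modules closed under kernels and extensions. -/
def MIsKEClosed (P : ModuleCat.{u} R → Prop) : Prop :=
  IsSubcatOfFGMod R P ∧ MIsAdditive R P ∧ MClosedUnderKernels R P ∧
    MClosedUnderExtensions R P

/-- `Ass X`: the union of the associated primes of members of `X`. -/
def AssOf (P : ModuleCat.{u} R → Prop) : Set (Ideal R) :=
  {p | ∃ M : ModuleCat.{u} R, P M ∧ p ∈ associatedPrimes R M}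

/-- `mod^ass_Φ R`: the finitely generated modules all of whose associated
primes lie in `Φ`. -/
def modAss (Φ : Set (Ideal R)) : ModuleCat.{u} R → Prop :=
  fun M => Module.Finite R M ∧ associatedPrimes R M ⊆ Φ

end Defs

open LinearMap

section KEClosed

variable {R : Type u} [CommRing R] {X : ModuleCat.{u} R → Prop}

/-- A module isomorphic, up to multiplication by an element outside `q`, to a submodule of `W`
lying in `X`. -/
def HasLattice (X : ModuleCat.{u} R → Prop) (q : Ideal R) (W : Type u) [AddCommGroup W]
    [Module R W] : Prop :=
  ∃ Z : ModuleCat.{u} R, X Z ∧ ∃ g : Z →ₗ[R] W, Function.Injective g ∧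
    ∃ s ∉ q, ∀ w, s • w ∈ range g

lemma MIsKEClosed.of_equiv (hX : MIsKEClosed R X) {M N : Type u} [AddCommGroup M] [Module R M]
    [AddCommGroup N] [Module R N] (e : M ≃ₗ[R] N) (h : X (ModuleCat.of R M)) :
    X (ModuleCat.of R N) :=
  hX.2.1.2.1 (ModuleCat.of R M) (ModuleCat.of R N) e h

lemma MIsKEClosed.pi (hX : MIsKEClosed R X) {M : Type u} [AddCommGroup M] [Module R M]
    (h : X (ModuleCat.of R M)) (n : ℕ) : X (ModuleCat.of R (Fin n → M)) := by
  induction n with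
  | zero => exact hX.2.1.1 (ModuleCat.of R (Fin 0 → M)) (inferInstanceAs (Subsingleton (Fin 0 → M)))
  | succ n ih =>
    exact hX.of_equiv (Fin.consLinearEquiv R fun _ : Fin (n + 1) ↦ M) (hX.2.1.2.2 _ _ h ih)

/-- The elements of a module killed by an ideal form a module in `X`. -/
lemma MIsKEClosed.torsionBySet [IsNoetherianRing R] (hX : MIsKEClosed R X) {M : Type u}
    [AddCommGroup M] [Module R M] (h : X (ModuleCat.of R M)) (I : Ideal R) :
    X (ModuleCat.of R (Submodule.torsionBySet R M I)) := by
  obtain ⟨n, a, rfl⟩ := Submodule.fg_iff_exists_fin_generating_family.mp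
    (IsNoetherian.noetherian I)
  have key : Submodule.torsionBySet R M (Submodule.span R (Set.range a) : Ideal R) =
      ker (LinearMap.pi fun i ↦ LinearMap.lsmul R M (a i)) := by
    change Submodule.torsionBySet R M (Ideal.span (Set.range a) : Ideal R) = _
    rw [← Submodule.torsionBySet_eq_torsionBySet_span]
    ext x
    simp [Submodule.mem_torsionBySet_iff, funext_iff]
  rw [key]
  exact hX.2.2.1 (ModuleCat.of R M) (ModuleCat.of R (Fin n → M)) _ h (hX.pi h n)

lemma HasLattice.of_exact (hX : MIsKEClosed R X) {q : Ideal R} (hq : q.IsPrime)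
    {W₁ W W₂ : Type u} [AddCommGroup W₁] [Module R W₁] [AddCommGroup W] [Module R W]
    [AddCommGroup W₂] [Module R W₂] {i : W₁ →ₗ[R] W} {p : W →ₗ[R] W₂}
    (hi : Function.Injective i) (hip : Function.Exact i p) (hp : Function.Surjective p)
    (htf : ∀ s ∉ q, ∀ x : W₂, s • x = 0 → x = 0)
    (h₁ : HasLattice X q W₁) (h₂ : HasLattice X q W₂) : HasLattice X q W := by
  obtain ⟨Z₁, hZ₁, g₁, hg₁, t, ht, h₁⟩ := h₁
  obtain ⟨Z₂, hZ₂, g₂, hg₂, s, hs, h₂⟩ := h₂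
  have hpi (x) : p (i x) = 0 := hip.apply_apply_eq_zero x
  let E : Submodule R W := range (i ∘ₗ g₁) ⊔ ((range g₂).comap p).map (LinearMap.lsmul R W t)
  have memE (w : W) : w ∈ E ↔ ∃ z w', p w' ∈ range g₂ ∧ w = i (g₁ z) + t • w' := by
    simp only [E, Submodule.mem_sup, LinearMap.mem_range, Submodule.mem_map, Submodule.mem_comap]
    constructor
    · rintro ⟨_, ⟨z, rfl⟩, _, ⟨w', h, rfl⟩, rfl⟩
      exact ⟨z, w', h, rfl⟩
    · rintro ⟨z, w', h, rfl⟩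
      exact ⟨_, ⟨z, rfl⟩, _, ⟨w', h, rfl⟩, rfl⟩
  let f : E →ₗ[R] W₂ := p.domRestrict E
  have hker : X (ModuleCat.of R (ker f)) := by
    have hmem (z : Z₁) : (i ∘ₗ g₁) z ∈ E := (memE _).2 ⟨z, 0, by simp, by simp⟩
    let φ : Z₁ →ₗ[R] ker f :=
      codRestrict (ker f) (codRestrict E (i ∘ₗ g₁) hmem) fun z ↦ by
        simp [f, hpi]
    refine hX.of_equiv (LinearEquiv.ofBijective φ ⟨fun x y hxy ↦ ?_, ?_⟩) hZ₁
    · exact hg₁ (hi (congrArg (fun w : ker f ↦ ((w : E) : W)) hxy))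
    · rintro ⟨⟨w, hw⟩, hwk⟩
      obtain ⟨z, w', hw', rfl⟩ := (memE w).1 hw
      have h0 : p w' = 0 := by
        refine htf t ht _ ?_
        simpa [f, hpi] using hwk
      obtain ⟨w₁, rfl⟩ := (hip w').1 h0
      obtain ⟨z', hz'⟩ := h₁ w₁
      refine ⟨z + z', Subtype.ext (Subtype.ext ?_)⟩
      simp [φ, hz']
  have hquot : X (ModuleCat.of R (E ⧸ ker f)) := by
    refine hX.of_equiv f.quotKerEquivRange.symm ?_
    let φ : Z₂ →ₗ[R] range f := codRestrict (range f) (t • g₂) fun z ↦ by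
      obtain ⟨w', hw'⟩ := hp (g₂ z)
      exact ⟨⟨t • w', (memE _).2 ⟨0, w', ⟨z, hw'.symm⟩, by simp⟩⟩, by simp [f, hw']⟩
    refine hX.of_equiv (LinearEquiv.ofBijective φ ⟨?_, ?_⟩) hZ₂
    · rw [injective_iff_map_eq_zero]
      intro z hz
      refine (injective_iff_map_eq_zero g₂).1 hg₂ z (htf t ht _ ?_)
      exact congrArg Subtype.val hz
    · rintro ⟨_, ⟨w, hw⟩, rfl⟩
      obtain ⟨z, w', ⟨z', hz'⟩, rfl⟩ := (memE w).1 hw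
      refine ⟨z', Subtype.ext ?_⟩
      simp [φ, f, hpi, hz']
  refine ⟨ModuleCat.of R E, hX.2.2.2 (ModuleCat.of R E) (ker f) hker hquot, E.subtype,
    E.injective_subtype, t * s, fun h ↦ (hq.mem_or_mem h).elim ht hs, fun w ↦ ?_⟩
  rw [Submodule.range_subtype]
  exact (memE _).2 ⟨0, s • w, by simpa using h₂ (p w), by simp [mul_smul]⟩

/-- In a finite module, denominators outside a prime can be chosen uniformly. -/
lemma exists_smul_mem_of_finite {q : Ideal R} (hq : q.IsPrime) {M : Type u} [AddCommGroup M]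
    [Module R M] [Module.Finite R M] (P : Submodule R M) (h : ∀ x, ∃ s ∉ q, s • x ∈ P) :
    ∃ s ∉ q, ∀ x, s • x ∈ P := by
  obtain ⟨n, a, ha⟩ := Submodule.fg_iff_exists_fin_generating_family.mp
    (Module.Finite.fg_top (R := R) (M := M))
  choose s hs hsP using fun i ↦ h (a i)
  refine ⟨∏ i, s i, fun hmem ↦ ?_, fun x ↦ ?_⟩
  · obtain ⟨i, -, hi⟩ := (hq.prod_mem_iff).1 hmem
    exact hs i hi
  · have hx : x ∈ Submodule.span R (Set.range a) := ha ▸ Submodule.mem_top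
    induction hx using Submodule.span_induction with
    | mem x hx =>
      obtain ⟨i, rfl⟩ := hx
      rw [← Finset.prod_erase_mul _ _ (Finset.mem_univ i), mul_smul]
      exact P.smul_mem _ (hsP i)
    | zero => simp
    | add x y _ _ hx hy => rw [smul_add]; exact P.add_mem hx hy
    | smul r x _ hx => rw [smul_comm]; exact P.smul_mem _ hx

/-- A finite module killed by a prime `q` contains a free `R ⧸ q`-module as a lattice. -/
lemma exists_free_lattice {q : Ideal R} (hq : q.IsPrime) {U : Type u} [AddCommGroup U]
    [Module R U] [IsNoetherian R U] (hqU : ∀ a ∈ q, ∀ x : U, a • x = 0) :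
    ∃ (n : ℕ) (e : (Fin n → R ⧸ q) →ₗ[R] U), Function.Injective e ∧
      ∃ s ∉ q, ∀ x, s • x ∈ range e := by
  obtain ⟨S, ⟨n, e, he, rfl⟩, hmax⟩ := set_has_maximal_iff_noetherian.mpr ‹IsNoetherian R U›
    {S | ∃ (n : ℕ) (e : (Fin n → R ⧸ q) →ₗ[R] U), Function.Injective e ∧ range e = S}
    ⟨_, 0, 0, Function.injective_of_subsingleton _, rfl⟩
  refine ⟨n, e, he, exists_smul_mem_of_finite hq _ fun x ↦ ?_⟩
  by_contra! hx
  let c : (R ⧸ q) →ₗ[R] U := Submodule.liftQ q (toSpanSingleton R U x) fun a ha ↦ hqU a ha x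
  let e' : (Fin (n + 1) → R ⧸ q) →ₗ[R] U :=
    (c.coprod e) ∘ₗ (Fin.consLinearEquiv R fun _ : Fin (n + 1) ↦ R ⧸ q).symm.toLinearMap
  have hrange : range e' = range c ⊔ range e := by
    rw [LinearMap.range_comp_of_range_eq_top _ (LinearEquiv.range _), LinearMap.range_coprod]
  refine hmax (range e') ⟨n + 1, e', ?_, rfl⟩ ?_
  · suffices h : Function.Injective (c.coprod e) from h.comp (LinearEquiv.injective _)
    rw [injective_iff_map_eq_zero]
    rintro ⟨r, v⟩ h
    obtain ⟨r, rfl⟩ := Submodule.Quotient.mk_surjective q r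
    have h' : r • x + e v = 0 := h
    have hr : r ∈ q := by
      by_contra hr
      exact hx r hr ⟨-v, by rw [map_neg]; exact neg_eq_of_add_eq_zero_left h'⟩
    have hv : v = 0 := by
      refine (injective_iff_map_eq_zero e).1 he v ?_
      rwa [hqU r hr, zero_add] at h'
    exact Prod.ext ((Submodule.Quotient.mk_eq_zero q).2 hr) hv
  · rw [hrange, right_lt_sup]
    intro hle
    refine hx 1 (fun h ↦ hq.ne_top ((Ideal.eq_top_iff_one q).2 h)) (hle ⟨Submodule.Quotient.mk 1, ?_⟩)
    rfl

lemma HasLattice.pi {q : Ideal R} (hq : q.IsPrime) {U : Type u} [AddCommGroup U] [Module R U]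
    (hU : X (ModuleCat.of R U)) (htf : ∀ s ∉ q, ∀ x : U, s • x = 0 → x = 0)
    {B : Type u} [AddCommGroup B] [Module R B] {n : ℕ}
    {e : (Fin n → R ⧸ q) →ₗ[R] U} (he : Function.Injective e)
    (hse : ∃ s ∉ q, ∀ x, s • x ∈ range e)
    {j : (R ⧸ q) →ₗ[R] B} (hj : Function.Injective j) (htj : ∃ t ∉ q, ∀ b, t • b ∈ range j) :
    HasLattice X q (Fin n → B) := by
  obtain ⟨s, hs, hse⟩ := hse
  obtain ⟨t, ht, htj⟩ := htj
  let ψ : U →ₗ[R] (Fin n → R ⧸ q) := (LinearEquiv.ofInjective e he).symm.toLinearMap ∘ₗ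
    codRestrict (range e) (s • LinearMap.id) hse
  have hψ (u : U) : e (ψ u) = s • u := congrArg Subtype.val
    ((LinearEquiv.ofInjective e he).apply_symm_apply ⟨s • u, hse u⟩)
  refine ⟨ModuleCat.of R U, hU, j.compLeft (Fin n) ∘ₗ ψ, ?_, t * s,
    fun h ↦ (hq.mem_or_mem h).elim ht hs, fun w ↦ ?_⟩
  · have hj' : Function.Injective (j.compLeft (Fin n)) := hj.comp_left
    refine hj'.comp ((injective_iff_map_eq_zero ψ).2 fun u hu ↦ htf s hs u ?_)
    rw [← hψ, hu, map_zero]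
  · choose c hc using fun i ↦ htj (w i)
    refine ⟨e c, ?_⟩
    have h : ψ (e c) = s • c := he (by rw [hψ, map_smul])
    rw [LinearMap.comp_apply, h]
    ext i
    change j (s • c i) = (t * s) • w i
    rw [map_smul, hc, ← mul_smul, mul_comm]

/-- The elements which are sent into `P` by some scalar outside the prime `q`. -/
def primeSaturation {q : Ideal R} (hq : q.IsPrime) {M : Type u} [AddCommGroup M] [Module R M]
    (P : Submodule R M) : Submodule R M where
  carrier := {x | ∃ s ∉ q, s • x ∈ P}
  zero_mem' := ⟨1, q.ne_top_iff_one.1 hq.ne_top, by simp⟩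
  add_mem' := by
    rintro x y ⟨s, hs, hx⟩ ⟨t, ht, hy⟩
    refine ⟨s * t, fun h ↦ (hq.mem_or_mem h).elim hs ht, ?_⟩
    rw [smul_add, mul_smul, mul_smul, smul_comm s t x]
    exact P.add_mem (P.smul_mem _ hx) (P.smul_mem _ hy)
  smul_mem' := by
    rintro r x ⟨s, hs, hx⟩
    exact ⟨s, hs, by rw [smul_comm]; exact P.smul_mem _ hx⟩

lemma mem_primeSaturation {q : Ideal R} (hq : q.IsPrime) {M : Type u} [AddCommGroup M]
    [Module R M] {P : Submodule R M} {x : M} :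
    x ∈ primeSaturation hq P ↔ ∃ s ∉ q, s • x ∈ P := Iff.rfl

lemma le_primeSaturation {q : Ideal R} (hq : q.IsPrime) {M : Type u} [AddCommGroup M]
    [Module R M] (P : Submodule R M) : P ≤ primeSaturation hq P :=
  fun x hx ↦ ⟨1, q.ne_top_iff_one.1 hq.ne_top, by simpa⟩

lemma mem_primeSaturation_of_smul_mem {q : Ideal R} (hq : q.IsPrime) {M : Type u}
    [AddCommGroup M] [Module R M] {P : Submodule R M} {s : R} (hs : s ∉ q) {x : M}
    (h : s • x ∈ primeSaturation hq P) : x ∈ primeSaturation hq P := by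
  obtain ⟨t, ht, h⟩ := h
  exact ⟨t * s, fun h ↦ (hq.mem_or_mem h).elim ht hs, by rwa [mul_smul]⟩

lemma HasLattice.pi_quotient (hX : MIsKEClosed R X) {q : Ideal R} (hq : q.IsPrime)
    {U : Type u} [AddCommGroup U] [Module R U]
    (hU : X (ModuleCat.of R U)) (htf : ∀ s ∉ q, ∀ x : U, s • x = 0 → x = 0) {n : ℕ}
    {e : (Fin n → R ⧸ q) →ₗ[R] U} (he : Function.Injective e)
    (hse : ∃ s ∉ q, ∀ x, s • x ∈ range e)
    {M : Type u} [AddCommGroup M] [Module R M] [IsNoetherian R M] {k : ℕ} (N : Submodule R M)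
    (hN : ∀ s ∉ q, ∀ x, s • x ∈ N → x ∈ N) (hk : q ^ k • (⊤ : Submodule R M) ≤ N) :
    HasLattice X q (Fin n → M ⧸ N) := by
  induction N using IsNoetherian.induction with
  | hgt N ih =>
  by_cases hNtop : N = ⊤
  · subst hNtop
    exact ⟨ModuleCat.of R PUnit, hX.2.1.1 (ModuleCat.of R PUnit)
      (inferInstanceAs (Subsingleton PUnit)), 0,
      fun x y _ ↦ Subsingleton.elim (α := PUnit) x y, 1, q.ne_top_iff_one.1 hq.ne_top,
      fun w ↦ ⟨0, Subsingleton.elim _ _⟩⟩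
  obtain ⟨x, hxN, hxq⟩ : ∃ x ∉ N, ∀ a ∈ q, a • x ∈ N := by
    classical
    have hex : ∃ j, q ^ j • (⊤ : Submodule R M) ≤ N := ⟨k, hk⟩
    obtain ⟨m, hm⟩ : ∃ m, Nat.find hex = m + 1 := by
      refine Nat.exists_eq_succ_of_ne_zero fun h0 ↦ hNtop ?_
      have := Nat.find_spec hex
      rw [h0, pow_zero, Ideal.one_eq_top, Submodule.top_smul] at this
      exact top_le_iff.1 this
    obtain ⟨x, hx, hxN⟩ := SetLike.not_le_iff_exists.1 (Nat.find_min hex (m := m) (by lia))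
    refine ⟨x, hxN, fun a ha ↦ Nat.find_spec hex ?_⟩
    rw [hm, pow_succ', ← smul_eq_mul, Submodule.smul_assoc]
    exact Submodule.smul_mem_smul ha hx
  let N' := primeSaturation hq (N ⊔ Submodule.span R {x})
  have hsat : ∀ s ∉ q, ∀ y, s • y ∈ N' → y ∈ N' :=
    fun s hs y ↦ mem_primeSaturation_of_smul_mem hq hs
  have hle : N ≤ N' := le_sup_left.trans (le_primeSaturation hq _)
  have hxN' : x ∈ N' := le_primeSaturation hq _
    (Submodule.mem_sup_right (Submodule.mem_span_singleton_self x))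
  have h₂ := ih N' (lt_of_le_of_ne hle fun h ↦ hxN (h ▸ hxN')) hsat (hk.trans hle)
  let f : (M ⧸ N) →ₗ[R] M ⧸ N' := Submodule.factor hle
  have hf : Function.Surjective f := Submodule.factor_surjective hle
  have h₁ : HasLattice X q (Fin n → ker f) := by
    let j : (R ⧸ q) →ₗ[R] ker f := Submodule.liftQ q
      (toSpanSingleton R (ker f) ⟨Submodule.Quotient.mk x, (Submodule.Quotient.mk_eq_zero N').2 hxN'⟩)
      fun a ha ↦ Subtype.ext ((Submodule.Quotient.mk_eq_zero N).2 (hxq a ha))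
    refine HasLattice.pi hq hU htf he hse (j := j) ?_ (exists_smul_mem_of_finite hq _ ?_)
    · rw [injective_iff_map_eq_zero]
      intro r hr
      obtain ⟨r, rfl⟩ := Submodule.Quotient.mk_surjective q r
      refine (Submodule.Quotient.mk_eq_zero q).2 (by_contra fun hrq ↦ hxN (hN r hrq x ?_))
      exact (Submodule.Quotient.mk_eq_zero N).1 (congrArg Subtype.val hr)
    · rintro ⟨y, hy⟩
      obtain ⟨y, rfl⟩ := Submodule.Quotient.mk_surjective N y
      obtain ⟨s, hs, hsy⟩ := (Submodule.Quotient.mk_eq_zero N').1 hy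
      obtain ⟨z, hz, w, hw, hzw⟩ := Submodule.mem_sup.1 hsy
      obtain ⟨r, rfl⟩ := Submodule.mem_span_singleton.1 hw
      refine ⟨s, hs, Submodule.Quotient.mk r, Subtype.ext ?_⟩
      change (Submodule.Quotient.mk (r • x) : M ⧸ N) = Submodule.Quotient.mk (s • y)
      rw [eq_comm, Submodule.Quotient.eq, show s • y = z + r • x from hzw.symm, add_sub_cancel_right]
      exact hz
  refine HasLattice.of_exact hX hq (i := (ker f).subtype.compLeft (Fin n))
    (p := f.compLeft (Fin n)) (ker f).injective_subtype.comp_left ?_ hf.comp_left ?_ h₁ h₂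
  · intro w
    constructor
    · intro h
      exact ⟨fun i ↦ ⟨w i, congrFun h i⟩, rfl⟩
    · rintro ⟨v, rfl⟩
      exact funext fun i ↦ (v i).2
  · intro s hs v hv
    ext i
    obtain ⟨y, hy⟩ := Submodule.Quotient.mk_surjective N' (v i)
    have h := congrFun hv i
    rw [Pi.smul_apply, ← hy] at h
    rw [← hy]
    exact (Submodule.Quotient.mk_eq_zero N').2 (hsat s hs y ((Submodule.Quotient.mk_eq_zero N').1 h))

lemma mem_associatedPrimes_iff_exists [IsNoetherianRing R] {M : Type u} [AddCommGroup M]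
    [Module R M] {p : Ideal R} :
    p ∈ associatedPrimes R M ↔ p.IsPrime ∧ ∃ x : M, ∀ r, r ∈ p ↔ r • x = 0 := by
  rw [AssociatedPrimes.mem_iff, isAssociatedPrime_iff]
  simp [SetLike.ext_iff, Submodule.mem_colon_singleton]

/-- A maximal associated prime `q` can be removed inside `X` without losing an associated prime
that does not contain `q`. -/
lemma MIsKEClosed.exists_submodule_notMem_associatedPrimes [IsNoetherianRing R]
    (hX : MIsKEClosed R X) {M : Type u} [AddCommGroup M] [Module R M] [Module.Finite R M]
    (hM : X (ModuleCat.of R M)) {p q : Ideal R} (hqM : q ∈ associatedPrimes R M)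
    (hmax : ∀ q' ∈ associatedPrimes R M, q ≤ q' → q' = q)
    (hpM : p ∈ associatedPrimes R M) (hqp : ¬ q ≤ p) :
    ∃ N : Submodule R M, X (ModuleCat.of R N) ∧ p ∈ associatedPrimes R N ∧
      q ∉ associatedPrimes R N := by
  obtain ⟨hq, u, hu⟩ := mem_associatedPrimes_iff_exists.1 hqM
  obtain ⟨hp, x, hx⟩ := mem_associatedPrimes_iff_exists.1 hpM
  let U := Submodule.torsionBySet R M (q : Set R)
  have memU (y : M) : y ∈ U ↔ ∀ a ∈ q, a • y = 0 := by
    simp [U, Submodule.mem_torsionBySet_iff]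
  have htf : ∀ s ∉ q, ∀ y : U, s • y = 0 → y = 0 := by
    rintro s hs ⟨y, hy⟩ hsy
    by_contra hy0
    have hy0' : y ≠ 0 := fun h ↦ hy0 (Subtype.ext h)
    obtain ⟨P, hP, hyP⟩ := exists_le_isAssociatedPrime_of_isNoetherianRing R y hy0'
    have hPq := hmax P hP fun a ha ↦ hyP <| by
      rw [Submodule.mem_colon_singleton, Submodule.mem_bot]
      exact (memU y).1 hy a ha
    refine hs (hPq ▸ hyP ?_)
    rw [Submodule.mem_colon_singleton, Submodule.mem_bot]
    exact congrArg Subtype.val hsy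
  obtain ⟨n, e, he, hse⟩ := exists_free_lattice hq (U := U)
    fun a ha y ↦ Subtype.ext ((memU y).1 y.2 a ha)
  have hu0 : u ≠ 0 := fun h ↦ hq.ne_top ((Ideal.eq_top_iff_one q).2 ((hu 1).2 (by simp [h])))
  have hn : n ≠ 0 := by
    rintro rfl
    obtain ⟨s, hs, hse⟩ := hse
    obtain ⟨c, hc⟩ := hse ⟨u, (memU u).2 fun a ha ↦ (hu a).1 ha⟩
    rw [Subsingleton.elim c 0, map_zero] at hc
    exact hu0 (congrArg Subtype.val (htf s hs _ hc.symm))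
  obtain ⟨k, hk⟩ := Ideal.exists_pow_inf_eq_pow_smul q U
  have hAR : q ^ (k + 1) • (⊤ : Submodule R M) ⊓ U = ⊥ := by
    rw [hk (k + 1) (by lia), eq_bot_iff, Nat.add_sub_cancel_left, pow_one, Submodule.smul_le]
    intro a ha y hy
    exact (memU y).1 hy.2 a ha
  let N := primeSaturation hq (q ^ (k + 1) • (⊤ : Submodule R M))
  obtain ⟨Z, hZ, g, hg, s, hs, hsg⟩ := HasLattice.pi_quotient hX hq
    (hX.torsionBySet hM q) htf he hse N
    (fun s hs y ↦ mem_primeSaturation_of_smul_mem hq hs) (le_primeSaturation hq _)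
  let φ : M →ₗ[R] (Fin n → M ⧸ N) := LinearMap.pi fun _ ↦ N.mkQ
  let f : M →ₗ[R] Z := (LinearEquiv.ofInjective g hg).symm.toLinearMap ∘ₗ
    codRestrict (range g) (s • φ) fun y ↦ hsg (φ y)
  have hf (y : M) : g (f y) = s • φ y := congrArg Subtype.val
    ((LinearEquiv.ofInjective g hg).apply_symm_apply ⟨s • φ y, hsg (φ y)⟩)
  have hker : ker f = N := by
    ext y
    rw [LinearMap.mem_ker, ← map_eq_zero_iff g hg, hf]
    constructor
    · intro h
      have h := congrFun h ⟨0, Nat.pos_of_ne_zero hn⟩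
      exact mem_primeSaturation_of_smul_mem hq hs ((Submodule.Quotient.mk_eq_zero N).1 h)
    · intro h
      ext i
      exact (Submodule.Quotient.mk_eq_zero N).2 (N.smul_mem s h)
  refine ⟨N, hker ▸ hX.2.2.1 (ModuleCat.of R M) Z f hM hZ, ?_, fun h ↦ ?_⟩
  · obtain ⟨a, ha, hap⟩ := SetLike.not_le_iff_exists.1
      (fun h : q ^ (k + 1) ≤ p ↦ hqp (hp.le_of_pow_le h))
    refine mem_associatedPrimes_iff_exists.2 ⟨hp,
      ⟨a • x, le_primeSaturation hq _ (Submodule.smul_mem_smul ha trivial)⟩, fun r ↦ ?_⟩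
    have h : r • a • x = 0 ↔ r ∈ p := by
      rw [← mul_smul, ← hx]
      exact ⟨fun h ↦ (hp.mem_or_mem h).resolve_right hap, p.mul_mem_right a⟩
    rw [← h, Subtype.ext_iff]
    rfl
  · obtain ⟨-, ⟨y, t, ht, hty⟩, hy⟩ := mem_associatedPrimes_iff_exists.1 h
    have hyU : y ∈ U := (memU y).2 fun a ha ↦ congrArg Subtype.val ((hy a).1 ha)
    have h0 : t • y ∈ (⊥ : Submodule R M) := hAR ▸ ⟨hty, U.smul_mem t hyU⟩
    exact ht ((hy t).2 (Subtype.ext h0))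

/-- Each associated prime of a module in `X` is the only associated prime of a module in `X`. -/
lemma MIsKEClosed.exists_associatedPrimes_eq_singleton [IsNoetherianRing R]
    (hX : MIsKEClosed R X) {p : Ideal R} {M : Type u} [AddCommGroup M] [Module R M]
    (hM : X (ModuleCat.of R M)) (hpM : p ∈ associatedPrimes R M) :
    ∃ N : ModuleCat.{u} R, X N ∧ associatedPrimes R N = {p} := by
  suffices H : ∀ (d : ℕ) (M : ModuleCat.{u} R), X M → p ∈ associatedPrimes R M →
      (∀ q ∈ associatedPrimes R M, p ≤ q) → (associatedPrimes R M).ncard = d →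
      ∃ N : ModuleCat.{u} R, X N ∧ associatedPrimes R N = {p} by
    obtain ⟨hp, x, hx⟩ := mem_associatedPrimes_iff_exists.1 hpM
    refine H _ _ (hX.torsionBySet hM p) (mem_associatedPrimes_iff_exists.2 ⟨hp, ⟨x, ?_⟩, ?_⟩) ?_ rfl
    · rw [Submodule.mem_torsionBySet_iff]
      exact fun a ↦ (hx a).1 a.2
    · intro r
      rw [hx, Subtype.ext_iff]
      rfl
    · intro q hqM a ha
      obtain ⟨-, y, hy⟩ := mem_associatedPrimes_iff_exists.1 hqM
      exact (hy a).2 (Subtype.ext ((Submodule.mem_torsionBySet_iff _ _).1 y.2 ⟨a, ha⟩))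
  intro d
  induction d using Nat.strong_induction_on with
  | _ d ih =>
  rintro M hM hpM hle rfl
  have := hX.1 M hM
  have hfin := associatedPrimes.finite R M
  obtain ⟨q, hpq, hqmax⟩ := hfin.exists_le_maximal hpM
  have hmax : ∀ q' ∈ associatedPrimes R M, q ≤ q' → q' = q :=
    fun q' h' h ↦ (hqmax.eq_of_le h' h).symm
  by_cases hqp : q ≤ p
  · refine ⟨M, hM, Set.eq_singleton_iff_unique_mem.2 ⟨hpM, fun q' hq' ↦ ?_⟩⟩
    rw [hmax q' hq' (hqp.trans (hle q' hq')), hqp.antisymm hpq]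
  · obtain ⟨N, hN, hpN, hqN⟩ :=
      hX.exists_submodule_notMem_associatedPrimes hM hqmax.prop hmax hpM hqp
    have hsub : associatedPrimes R N ⊆ associatedPrimes R M :=
      associatedPrimes.subset_of_injective N.injective_subtype
    exact ih _ (Set.ncard_lt_ncard (hsub.ssubset_of_mem_notMem hqmax.prop hqN) hfin)
      (ModuleCat.of R N) hN hpN (fun q hq ↦ hle q (hsub hq)) rfl

end KEClosed

theorem KE_inter_modAss (R : Type u) [CommRing R] [IsNoetherianRing R]
    (X : ModuleCat.{u} R → Prop) (hX : MIsKEClosed R X)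
    (Φ : Set (Ideal R)) (hΦ : Φ ⊆ AssOf R X) :
    MIsKEClosed R (fun M => X M ∧ modAss R Φ M) ∧
      AssOf R (fun M => X M ∧ modAss R Φ M) = Φ := by
  have hinter (M : ModuleCat.{u} R) (hM : X M) (hΦM : associatedPrimes R M ⊆ Φ) :
      X M ∧ modAss R Φ M := ⟨hM, hX.1 M hM, hΦM⟩
  refine ⟨⟨fun M hM ↦ hX.1 M hM.1, ⟨fun M hM ↦ ?_, fun M N e hM ↦ ?_, fun M N hM hN ↦ ?_⟩,
    fun M N f hM hN ↦ ?_, fun M N hN hQ ↦ ?_⟩, Set.Subset.antisymm ?_ fun p hp ↦ ?_⟩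
  · refine hinter _ (hX.2.1.1 M hM) ?_
    rw [associatedPrimes.eq_empty_of_subsingleton]
    exact Set.empty_subset _
  · exact hinter _ (hX.2.1.2.1 M N e hM.1) ((LinearEquiv.AssociatedPrimes.eq e).symm.trans_subset hM.2.2)
  · refine hinter _ (hX.2.1.2.2 M N hM.1 hN.1) ?_
    exact (associatedPrimes.prod R M N).trans_subset (Set.union_subset hM.2.2 hN.2.2)
  · exact hinter _ (hX.2.2.1 M N f hM.1 hN.1)
      ((associatedPrimes.subset_of_injective (ker f).injective_subtype).trans hM.2.2)
  · exact hinter _ (hX.2.2.2 M N hN.1 hQ.1) ((associatedPrimes.subset_union_of_exact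
      N.injective_subtype (LinearMap.exact_subtype_mkQ N)).trans
      (Set.union_subset hN.2.2 hQ.2.2))
  · rintro p ⟨M, hM, hp⟩
    exact hM.2.2 hp
  · obtain ⟨M, hM, hpM⟩ := hΦ hp
    obtain ⟨N, hN, hNp⟩ := hX.exists_associatedPrimes_eq_singleton hM hpM
    exact ⟨N, hinter N hN (by simpa [hNp] using hp), by simp [hNp]⟩
end
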